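/- Let M be a positive integer and let (q_0, q_0^*) be a connected component of (q', M+1) \ closure(U). Then for any r ∈ (q_0^*, M+1] the Hausdorff dimension of U ∩ (q_0^*, r) is strictly positive. -/

import Mathlib

open Set MeasureTheory Filter

noncomputable section

/-- The projection `π_q` of a digit sequence (0-indexed): `∑ d i / q^(i+1)`. -/
def piQ (q : ℝ) (d : ℕ → ℕ) : ℝ := ∑' i : ℕ, (d i : ℝ) / q ^ (i + 1)

/-- `d` is a `q`-expansion of `x` over the alphabet `{0,…,M}`. -/
def IsExpansion (M : ℕ) (q x : ℝ) (d : ℕ → ℕ) : Prop :=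
  (∀ i, d i ≤ M) ∧ piQ q d = x

/-- `U'_q`: digit sequences that are the unique `q`-expansion of their projection. -/
def UnivSeqs (M : ℕ) (q : ℝ) : Set (ℕ → ℕ) :=
  {d | (∀ i, d i ≤ M) ∧ ∀ e : ℕ → ℕ, IsExpansion M q (piQ q d) e → e = d}

/-- The set `U = U(M)` of univoque bases: `q ∈ (1, M+1]` such that `1` has a
unique `q`-expansion over `{0,…,M}`. -/
def UnivBases (M : ℕ) : Set ℝ :=
  {q | 1 < q ∧ q ≤ M + 1 ∧ ∃! d : ℕ → ℕ, IsExpansion M q 1 d}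

/-- The Komornik–Loreti constant `q'(M) = min U(M)`. -/
def KL (M : ℕ) : ℝ := sInf (UnivBases M)

/-- `(a, b)` is a connected component of `(q'(M), M+1) \ closure (U(M))`:
an open subinterval whose endpoints do not lie in that (open) set. -/
def CC (M : ℕ) (a b : ℝ) : Prop :=
  a < b ∧ Ioo a b ⊆ Ioo (KL M) (M + 1) \ closure (UnivBases M) ∧
    a ∉ Ioo (KL M) (M + 1) \ closure (UnivBases M) ∧
    b ∉ Ioo (KL M) (M + 1) \ closure (UnivBases M)

/-- `x ∈ [0, M/(q-1)]` has exactly two distinct `q`-expansions. -/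
def HasExactlyTwoExpansions (M : ℕ) (q x : ℝ) : Prop :=
  ∃ c d : ℕ → ℕ, c ≠ d ∧ IsExpansion M q x c ∧ IsExpansion M q x d ∧
    ∀ e : ℕ → ℕ, IsExpansion M q x e → e = c ∨ e = d

/-- `B_2(M)`: bases `q ∈ (1, M+1]` for which some `x ∈ [0, M/(q-1)]` has exactly
two `q`-expansions. -/
def B2 (M : ℕ) : Set ℝ :=
  {q | 1 < q ∧ q ≤ M + 1 ∧
    ∃ x ∈ Icc (0 : ℝ) (M / (q - 1)), HasExactlyTwoExpansions M q x}

/-- Strict lexicographic order on digit sequences. -/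
def seqLt (a b : ℕ → ℕ) : Prop := ∃ n, (∀ i < n, a i = b i) ∧ a n < b n

/-- Lexicographic order on digit sequences. -/
def seqLe (a b : ℕ → ℕ) : Prop := seqLt a b ∨ a = b

/-- A digit sequence is infinite if it does not end with `0^∞` after a last
nonzero digit (in particular `0^∞` is infinite). -/
def IsInfiniteSeq (a : ℕ → ℕ) : Prop := ¬∃ m, a m ≠ 0 ∧ ∀ i > m, a i = 0

/-- `a = α(q)`, the quasi-greedy `q`-expansion of `1`: the lexicographically
largest infinite `q`-expansion of `1`. -/
def IsQuasiGreedy (M : ℕ) (q : ℝ) (a : ℕ → ℕ) : Prop :=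
  IsExpansion M q 1 a ∧ IsInfiniteSeq a ∧
    ∀ b : ℕ → ℕ, IsExpansion M q 1 b → IsInfiniteSeq b → seqLe b a

/-- `b = β(q)`, the greedy `q`-expansion of `1`: the lexicographically largest
`q`-expansion of `1`. -/
def IsGreedy (M : ℕ) (q : ℝ) (b : ℕ → ℕ) : Prop :=
  IsExpansion M q 1 b ∧ ∀ c : ℕ → ℕ, IsExpansion M q 1 c → seqLe c b

/-- `w⁺`: increase the last digit of a word by one. -/
def plusWord : List ℕ → List ℕ
  | [] => []
  | [a] => [a + 1]
  | a :: b :: rest => a :: plusWord (b :: rest)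

/-- `w⁻`: decrease the last digit of a word by one. -/
def minusWord : List ℕ → List ℕ
  | [] => []
  | [a] => [a - 1]
  | a :: b :: rest => a :: minusWord (b :: rest)

/-- The reflection of a word: `\overline{w} = (M - w_1) ⋯ (M - w_k)`. -/
def reflWord (M : ℕ) (w : List ℕ) : List ℕ := w.map fun a => M - a

/-- The substitution `g(w) = w⁺ \overline{w⁺}`. -/
def gWord (M : ℕ) (w : List ℕ) : List ℕ := plusWord w ++ reflWord M (plusWord w)

/-- The periodic sequence `t^∞` determined by a word `t`. -/
def periodicSeq (t : List ℕ) (i : ℕ) : ℕ := t.getD (i % t.length) 0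

/-- Strict lexicographic order on words. -/
def wordLt (u v : List ℕ) : Prop := List.Lex (· < ·) u v

/-- Lexicographic order on words. -/
def wordLe (u v : List ℕ) : Prop := wordLt u v ∨ u = v

/-- The connected component `(q_0, q_0^*)` of `(q'(M), M+1) \ closure (U(M))` is
generated by the word `t`, and `θ = α(q_0^*)`: `α(q_0) = t^∞` and
`α(q_0^*) = lim_{n→∞} g^n(t)`, i.e. every `g^n(t)` is a prefix of `θ`. -/
def GeneratedBy (M : ℕ) (q₀ q₀star : ℝ) (t : List ℕ) (θ : ℕ → ℕ) : Prop :=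
  CC M q₀ q₀star ∧ t ≠ [] ∧ IsQuasiGreedy M q₀ (periodicSeq t) ∧
    IsQuasiGreedy M q₀star θ ∧
    ∀ n : ℕ, ∀ i < ((gWord M)^[n] t).length, ((gWord M)^[n] t).getD i 0 = θ i

/-! ### Digit sequences and their values -/

/-- The sequence `d` with its first `m` digits dropped. -/
def shiftSeq (m : ℕ) (d : ℕ → ℕ) : ℕ → ℕ := fun i => d (m + i)

/-- The reflection of a digit sequence over the alphabet `{0,…,M}`. -/
def reflSeq (M : ℕ) (d : ℕ → ℕ) : ℕ → ℕ := fun i => M - d i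

lemma shiftSeq_le {M : ℕ} {d : ℕ → ℕ} (hd : ∀ i, d i ≤ M) (m i : ℕ) : shiftSeq m d i ≤ M :=
  hd _

lemma reflSeq_le {M : ℕ} (d : ℕ → ℕ) (i : ℕ) : reflSeq M d i ≤ M := Nat.sub_le _ _

lemma shiftSeq_shiftSeq (m n : ℕ) (d : ℕ → ℕ) :
    shiftSeq m (shiftSeq n d) = shiftSeq (n + m) d := by
  funext i
  simp [shiftSeq, Nat.add_assoc]

lemma shiftSeq_reflSeq (M m : ℕ) (d : ℕ → ℕ) :
    shiftSeq m (reflSeq M d) = reflSeq M (shiftSeq m d) := rfl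

lemma shiftSeq_zero (d : ℕ → ℕ) : shiftSeq 0 d = d := by
  funext i
  simp [shiftSeq]

lemma hasSum_geometric_shift {q : ℝ} (hq : 1 < q) (M : ℝ) :
    HasSum (fun i : ℕ => M / q ^ (i + 1)) (M / (q - 1)) := by
  have h0 : 0 < q := by linarith
  have h := (hasSum_geometric_of_lt_one (r := q⁻¹) (by positivity) (inv_lt_one_of_one_lt₀ hq)).mul_left
    (M / q)
  have h1 : q - 1 ≠ 0 := by linarith
  have e1 : (fun i : ℕ => M / q * q⁻¹ ^ i) = fun i : ℕ => M / q ^ (i + 1) := by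
    funext i
    rw [inv_pow, pow_succ']
    field_simp
  have e2 : M / q * (1 - q⁻¹)⁻¹ = M / (q - 1) := by
    field_simp
  rwa [e1, e2] at h

lemma summable_piQ {M : ℕ} {q : ℝ} (hq : 1 < q) {d : ℕ → ℕ} (hd : ∀ i, d i ≤ M) :
    Summable fun i : ℕ => (d i : ℝ) / q ^ (i + 1) := by
  have h0 : 0 < q := by linarith
  refine Summable.of_nonneg_of_le (fun i => by positivity) (fun i => ?_)
    (hasSum_geometric_shift hq M).summable
  have : (d i : ℝ) ≤ M := by exact_mod_cast hd i
  gcongr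

lemma piQ_nonneg {q : ℝ} (hq : 1 < q) (d : ℕ → ℕ) : 0 ≤ piQ q d :=
  tsum_nonneg fun i => by have h0 : 0 < q := by linarith
                          positivity

lemma piQ_const {M : ℕ} {q : ℝ} (hq : 1 < q) : piQ q (fun _ => M) = M / (q - 1) :=
  (hasSum_geometric_shift hq M).tsum_eq

lemma piQ_reflSeq {M : ℕ} {q : ℝ} (hq : 1 < q) {d : ℕ → ℕ} (hd : ∀ i, d i ≤ M) :
    piQ q (reflSeq M d) = M / (q - 1) - piQ q d := by
  rw [← piQ_const (M := M) hq, piQ, piQ, piQ, ← Summable.tsum_sub]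
  · refine tsum_congr fun i => ?_
    rw [reflSeq, Nat.cast_sub (hd i), sub_div]
  · exact summable_piQ hq fun _ => le_rfl
  · exact summable_piQ hq hd

lemma piQ_le {M : ℕ} {q : ℝ} (hq : 1 < q) {d : ℕ → ℕ} (hd : ∀ i, d i ≤ M) :
    piQ q d ≤ M / (q - 1) := by
  have := piQ_nonneg hq (reflSeq M d)
  rw [piQ_reflSeq hq hd] at this
  linarith

lemma piQ_eq_head {M : ℕ} {q : ℝ} (hq : 1 < q) {d : ℕ → ℕ} (hd : ∀ i, d i ≤ M) :
    q * piQ q d = d 0 + piQ q (shiftSeq 1 d) := by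
  have h0 : 0 < q := by linarith
  rw [piQ, (summable_piQ hq hd).tsum_eq_zero_add, mul_add, piQ, ← tsum_mul_left]
  congr 1
  · rw [zero_add, pow_one]
    field_simp
  · refine tsum_congr fun i => ?_
    rw [shiftSeq, Nat.add_comm 1 i, pow_succ q (i + 1)]
    field_simp

lemma piQ_eq_step {M : ℕ} {q : ℝ} (hq : 1 < q) {d : ℕ → ℕ} (hd : ∀ i, d i ≤ M) (n : ℕ) :
    q * piQ q (shiftSeq n d) = d n + piQ q (shiftSeq (n + 1) d) := by
  rw [piQ_eq_head hq (shiftSeq_le hd n), shiftSeq_shiftSeq]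
  simp [shiftSeq]

lemma piQ_sub_of_agree {M : ℕ} {q : ℝ} (hq : 1 < q) {a b : ℕ → ℕ} (ha : ∀ i, a i ≤ M)
    (hb : ∀ i, b i ≤ M) (n : ℕ) (h : ∀ i < n, a i = b i) :
    q ^ n * (piQ q a - piQ q b) = piQ q (shiftSeq n a) - piQ q (shiftSeq n b) := by
  induction n with
  | zero => simp [shiftSeq_zero]
  | succ n ih =>
    have h1 := ih fun i hi => h i (by omega)
    have h2 := piQ_eq_step hq ha n
    have h3 := piQ_eq_step hq hb n
    rw [h n (by omega)] at h2
    rw [pow_succ', mul_assoc, h1]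
    linarith

lemma piQ_sub_of_first_diff {M : ℕ} {q : ℝ} (hq : 1 < q) {a b : ℕ → ℕ} (ha : ∀ i, a i ≤ M)
    (hb : ∀ i, b i ≤ M) (n : ℕ) (h : ∀ i < n, a i = b i) :
    q ^ (n + 1) * (piQ q a - piQ q b) =
      (a n - b n) + (piQ q (shiftSeq (n + 1) a) - piQ q (shiftSeq (n + 1) b)) := by
  have h1 := piQ_sub_of_agree hq ha hb n h
  have h2 := piQ_eq_step hq ha n
  have h3 := piQ_eq_step hq hb n
  rw [pow_succ', mul_assoc, h1]
  linarith

lemma piQ_anti {M : ℕ} {p q : ℝ} (hp : 1 < p) (hpq : p ≤ q) {d : ℕ → ℕ} (hd : ∀ i, d i ≤ M) :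
    piQ q d ≤ piQ p d := by
  have h0 : 0 < p := by linarith
  refine (summable_piQ (hp.trans_le hpq) hd).tsum_le_tsum (fun i => ?_) (summable_piQ hp hd)
  gcongr

lemma piQ_strictAnti {M : ℕ} {p q : ℝ} (hp : 1 < p) (hpq : p < q) {d : ℕ → ℕ}
    (hd : ∀ i, d i ≤ M) (hpos : 0 < piQ q d) : piQ q d < piQ p d := by
  have h0 : 0 < p := by linarith
  have h1 := piQ_eq_head hp hd
  have h2 := piQ_eq_head (hp.trans hpq) hd
  have h3 := piQ_anti hp hpq.le (shiftSeq_le hd 1)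
  nlinarith

/-- For bases bounded away from `1`, the value of a sequence is Lipschitz in the base. -/
lemma piQ_lipschitz {M : ℕ} {q₁ p q : ℝ} (h₁ : 1 < q₁) (hp : q₁ ≤ p) (hq : q₁ ≤ q) {d : ℕ → ℕ}
    (hd : ∀ i, d i ≤ M) :
    |piQ p d - piQ q d| ≤ M / (q₁ - 1) ^ 2 * |p - q| := by
  have hp1 := h₁.trans_le hp
  have hq1 := h₁.trans_le hq
  have h0 : 0 < q₁ := by linarith
  have hbd : ∀ e : ℕ → ℕ, (∀ i, e i ≤ M) → ∀ r, q₁ ≤ r → |piQ r e| ≤ M / (q₁ - 1) := by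
    intro e he r hr
    rw [abs_of_nonneg (piQ_nonneg (h₁.trans_le hr) e)]
    refine (piQ_le (h₁.trans_le hr) he).trans ?_
    have : 0 < q₁ - 1 := by linarith
    gcongr
  set A : ℝ := M / (q₁ - 1) ^ 2 * |p - q| with hA
  have hA' : A * (q₁ - 1) = M / (q₁ - 1) * |p - q| := by
    have : q₁ - 1 ≠ 0 := by linarith
    rw [hA]; field_simp
  set B : ℝ := 2 * (M / (q₁ - 1))
  have key : ∀ k : ℕ, ∀ e : ℕ → ℕ, (∀ i, e i ≤ M) → |piQ p e - piQ q e| ≤ A + B * (q₁⁻¹) ^ k := by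
    intro k
    induction k with
    | zero =>
      intro e he
      have h1 := hbd e he p hp
      have h2 := hbd e he q hq
      have h3 := abs_sub (piQ p e) (piQ q e)
      have h4 : 0 ≤ A := by positivity
      simp only [pow_zero, mul_one]
      linarith
    | succ k ih =>
      intro e he
      have h1 := piQ_eq_head hp1 he
      have h2 := piQ_eq_head hq1 he
      have h3 := ih _ (shiftSeq_le he 1)
      have h4 : p * (piQ p e - piQ q e) =
          (q - p) * piQ q e + (piQ p (shiftSeq 1 e) - piQ q (shiftSeq 1 e)) := by linarith
      have h5 : p * |piQ p e - piQ q e| ≤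
          |p - q| * (M / (q₁ - 1)) + (A + B * (q₁⁻¹) ^ k) := by
        calc p * |piQ p e - piQ q e| = |p * (piQ p e - piQ q e)| := by
              rw [abs_mul, abs_of_pos (by linarith : 0 < p)]
          _ ≤ |(q - p) * piQ q e| + |piQ p (shiftSeq 1 e) - piQ q (shiftSeq 1 e)| := by
              rw [h4]; exact abs_add_le _ _
          _ ≤ _ := by
              rw [abs_mul, abs_sub_comm q p]
              gcongr
              exact hbd e he q hq
      have h6 : q₁ * |piQ p e - piQ q e| ≤ p * |piQ p e - piQ q e| := by gcongr
      have h7 : q₁ * |piQ p e - piQ q e| ≤ q₁ * (A + B * (q₁⁻¹) ^ (k + 1)) := by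
        have : q₁ * (A + B * (q₁⁻¹) ^ (k + 1)) = q₁ * A + B * (q₁⁻¹) ^ k := by
          rw [pow_succ]; field_simp
        rw [this]
        nlinarith
      exact le_of_mul_le_mul_left h7 h0
  have hlim : Tendsto (fun k : ℕ => A + B * (q₁⁻¹) ^ k) atTop (nhds (A + B * 0)) :=
    ((tendsto_pow_atTop_nhds_zero_of_lt_one (by positivity) (inv_lt_one_of_one_lt₀ h₁)).const_mul
      B).const_add A
  simpa using ge_of_tendsto' hlim fun k => key k d hd

/-- Every point of `[0, M/(q-1)]` has a `q`-expansion. -/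
lemma exists_expansion {M : ℕ} {q : ℝ} (hq : 1 < q) (hqM : q ≤ M + 1) {x : ℝ}
    (hx0 : 0 ≤ x) (hx1 : x ≤ M / (q - 1)) : ∃ f, IsExpansion M q x f := by
  have hq1 : 0 < q - 1 := by linarith
  have h0 : 0 < q := by linarith
  set K : ℝ := M / (q - 1) with hK
  have hKq : q * K - M = K := by rw [hK]; field_simp; ring
  have hK1 : 1 ≤ K := by rw [hK, le_div_iff₀ hq1]; linarith
  have step : ∀ y : Icc (0 : ℝ) K, ∃ c : ℕ, c ≤ M ∧ q * y - c ∈ Icc (0 : ℝ) K := by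
    rintro ⟨y, hy0, hy1⟩
    by_cases h : ⌊q * y⌋₊ ≤ M
    · refine ⟨_, h, ?_, ?_⟩
      · have := Nat.floor_le (mul_nonneg h0.le hy0)
        simpa using this
      · have := Nat.lt_floor_add_one (q * y)
        dsimp only
        linarith
    · refine ⟨M, le_rfl, ?_, ?_⟩
      · have : (M : ℝ) ≤ q * y := by
          have := Nat.floor_le (mul_nonneg h0.le hy0)
          have h' : (M : ℝ) ≤ (⌊q * y⌋₊ : ℝ) := by exact_mod_cast (not_le.1 h).le
          linarith
        simpa using this
      · dsimp only
        nlinarith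
  choose c hcM hc using step
  let T : Icc (0 : ℝ) K → Icc (0 : ℝ) K := fun y => ⟨q * y - c y, hc y⟩
  let f : Icc (0 : ℝ) K → ℕ → ℕ := fun y i => c (T^[i] y)
  have hf : ∀ y i, f y i ≤ M := fun y i => hcM _
  have hshift : ∀ y, shiftSeq 1 (f y) = f (T y) := by
    intro y
    funext i
    simp only [shiftSeq, f, Nat.add_comm 1 i, Function.iterate_succ_apply]
  have key : ∀ k : ℕ, ∀ y, |piQ q (f y) - y| ≤ 2 * K * (q⁻¹) ^ k := by
    intro k
    induction k with
    | zero =>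
      intro y
      have h1 := piQ_nonneg hq (f y)
      have h2 := piQ_le hq (hf y)
      have h3 := y.2.1
      have h4 := y.2.2
      rw [abs_le]
      constructor <;> simp only [pow_zero, mul_one] <;> linarith
    | succ k ih =>
      intro y
      have h1 := piQ_eq_head hq (hf y)
      rw [hshift] at h1
      have h2 := ih (T y)
      have h3 : (T y : ℝ) = q * y - f y 0 := rfl
      have h4 : piQ q (f (T y)) - T y = q * (piQ q (f y) - y) := by rw [h3]; linarith
      rw [h4, abs_mul, abs_of_pos h0] at h2
      have h5 : q * (2 * K * (q⁻¹) ^ (k + 1)) = 2 * K * (q⁻¹) ^ k := by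
        rw [pow_succ]; field_simp
      rw [← h5] at h2
      exact le_of_mul_le_mul_left h2 h0
  refine ⟨f ⟨x, hx0, hx1⟩, hf _, ?_⟩
  have hlim : Tendsto (fun k : ℕ => 2 * K * (q⁻¹) ^ k) atTop (nhds (2 * K * 0)) :=
    (tendsto_pow_atTop_nhds_zero_of_lt_one (by positivity) (inv_lt_one_of_one_lt₀ hq)).const_mul _
  have h := ge_of_tendsto' hlim fun k => key k ⟨x, hx0, hx1⟩
  rw [mul_zero] at h
  have := abs_nonpos_iff.1 h
  linarith

/-! ### Lexicographically admissible sequences and univoque bases -/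

/-- Digit sequences with `\overline{d} < σ^m d` for all `m ≥ 0` and `σ^m d < d` for all `m ≥ 1`. -/
structure Admissible (M : ℕ) (d : ℕ → ℕ) : Prop where
  digit_le : ∀ i, d i ≤ M
  shift_lt : ∀ m, seqLt (shiftSeq (m + 1) d) d
  refl_lt : ∀ m, seqLt (reflSeq M (shiftSeq m d)) d

lemma seqLt_trichotomy (a b : ℕ → ℕ) : seqLt a b ∨ a = b ∨ seqLt b a := by
  by_cases h : a = b
  · exact Or.inr (Or.inl h)
  · have hex : ∃ n, a n ≠ b n := by
      by_contra! hc
      exact h (funext hc)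
    have hmin : ∀ i < Nat.find hex, a i = b i := fun i hi => not_not.1 (Nat.find_min hex hi)
    rcases lt_or_gt_of_ne (Nat.find_spec hex) with hlt | hgt
    · exact Or.inl ⟨_, hmin, hlt⟩
    · exact Or.inr (Or.inr ⟨_, fun i hi => (hmin i hi).symm, hgt⟩)

lemma seqLt.head_le {a b : ℕ → ℕ} (h : seqLt a b) : a 0 ≤ b 0 := by
  obtain ⟨n, h1, h2⟩ := h
  rcases Nat.eq_zero_or_pos n with rfl | hn
  · exact h2.le
  · exact (h1 0 hn).le

/-- If `n`-th digit of `d` can be changed to `c` with the tail absorbing the difference, then `d`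
is not the unique expansion of its value. -/
lemma digit_eq_of_unique {M : ℕ} {q : ℝ} (hq : 1 < q) (hqM : q ≤ M + 1) {d : ℕ → ℕ}
    (hd : IsExpansion M q 1 d) (huniq : ∀ e, IsExpansion M q 1 e → e = d) (n c : ℕ) (hc : c ≤ M)
    (h0 : (c : ℝ) ≤ d n + piQ q (shiftSeq (n + 1) d))
    (h1 : d n + piQ q (shiftSeq (n + 1) d) ≤ c + M / (q - 1)) : d n = c := by
  obtain ⟨f, hf, hfv⟩ := exists_expansion hq hqM
    (x := d n + piQ q (shiftSeq (n + 1) d) - c) (by linarith) (by linarith)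
  set e : ℕ → ℕ := fun i => if i < n then d i else if i = n then c else f (i - (n + 1)) with he
  have hen : e n = c := by simp [he]
  have heM : ∀ i, e i ≤ M := by
    intro i
    simp only [he]
    split_ifs
    exacts [hd.1 i, hc, hf _]
  have hshift : shiftSeq (n + 1) e = f := by
    funext i
    have h2 : ¬ n + 1 + i < n := by omega
    have h3 : ¬ n + 1 + i = n := by omega
    simp [shiftSeq, he, h2, h3]
  have hv := piQ_sub_of_first_diff hq heM hd.1 n fun i hi => by simp [he, hi]
  rw [hshift, hfv, hen, hd.2] at hv
  have hpos : 0 < q ^ (n + 1) := by positivity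
  have hz : piQ q e - 1 = 0 := by
    have : q ^ (n + 1) * (piQ q e - 1) = 0 := by rw [hv]; ring
    exact (mul_eq_zero.1 this).resolve_left hpos.ne'
  rw [← huniq e ⟨heM, by linarith⟩, hen]

lemma seqLt_of_piQ_lt {M : ℕ} {q : ℝ} (hq : 1 < q) {d y : ℕ → ℕ} (hd : IsExpansion M q 1 d)
    (htail : ∀ n, piQ q (shiftSeq (n + 1) d) < 1) (hy : ∀ i, y i ≤ M) (hlt : piQ q y < 1) :
    seqLt y d := by
  rcases seqLt_trichotomy y d with h | h | ⟨j, hj, hlt'⟩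
  · exact h
  · rw [h, hd.2] at hlt
    exact absurd hlt (lt_irrefl _)
  · exfalso
    have hv := piQ_sub_of_first_diff hq hd.1 hy j hj
    rw [hd.2] at hv
    have h1 : 0 < q ^ (j + 1) * (1 - piQ q y) := mul_pos (by positivity) (by linarith)
    have h2 : (d j : ℝ) + 1 ≤ y j := by exact_mod_cast hlt'
    have h3 := piQ_nonneg hq (shiftSeq (j + 1) y)
    have h4 := htail j
    linarith

/-- The unique expansion of `1` in a univoque base `q < M + 1` is admissible. -/
lemma admissible_of_unique {M : ℕ} {q : ℝ} (hq : 1 < q) (hqM : q < M + 1) {d : ℕ → ℕ}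
    (hd : IsExpansion M q 1 d) (huniq : ∀ e, IsExpansion M q 1 e → e = d) : Admissible M d := by
  have hq1 : 0 < q - 1 := by linarith
  have hK : 1 ≤ (M : ℝ) / (q - 1) := by rw [le_div_iff₀ hq1]; linarith
  have hup : ∀ n, d n < M → piQ q (shiftSeq (n + 1) d) < 1 := by
    intro n hn
    by_contra! hc
    have := digit_eq_of_unique hq hqM.le hd huniq n (d n + 1) hn
      (by push_cast; linarith)
      (by push_cast; linarith [piQ_le hq (shiftSeq_le hd.1 (n + 1))])
    omega
  have hlow : ∀ n, 0 < d n → piQ q (reflSeq M (shiftSeq (n + 1) d)) < 1 := by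
    intro n hn
    by_contra! hc
    rw [piQ_reflSeq hq (shiftSeq_le hd.1 _)] at hc
    have hcast : ((d n - 1 : ℕ) : ℝ) = d n - 1 := by rw [Nat.cast_sub hn]; simp
    have := digit_eq_of_unique hq hqM.le hd huniq n (d n - 1) ((Nat.sub_le _ _).trans (hd.1 n))
      (by rw [hcast]; linarith [piQ_nonneg hq (shiftSeq (n + 1) d)])
      (by rw [hcast]; linarith)
    omega
  have htail : ∀ n, piQ q (shiftSeq (n + 1) d) < 1 := by
    have aux : ∀ n, piQ q (shiftSeq n d) ≤ 1 → piQ q (shiftSeq (n + 1) d) < 1 := by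
      intro n hn
      rcases (hd.1 n).lt_or_eq with h | h
      · exact hup n h
      · have h1 := piQ_eq_step hq hd.1 n
        rw [h] at h1
        nlinarith
    intro n
    induction n with
    | zero => exact aux 0 (by rw [shiftSeq_zero, hd.2])
    | succ n ih => exact aux _ ih.le
  have hshift : ∀ m, seqLt (shiftSeq (m + 1) d) d := fun m =>
    seqLt_of_piQ_lt hq hd htail (shiftSeq_le hd.1 _) (htail m)
  have hd0 : 0 < d 0 := by
    rcases Nat.eq_zero_or_pos (d 0) with h | h
    · have h1 := piQ_eq_head hq hd.1
      rw [h, hd.2, Nat.cast_zero] at h1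
      linarith [htail 0]
    · exact h
  have hrtail : ∀ n, piQ q (reflSeq M (shiftSeq (n + 1) d)) < 1 := by
    intro n
    induction n with
    | zero => exact hlow 0 hd0
    | succ n ih =>
      rcases Nat.eq_zero_or_pos (d (n + 1)) with h | h
      · have h1 := piQ_eq_step hq (reflSeq_le (M := M) d) (n + 1)
        rw [shiftSeq_reflSeq, shiftSeq_reflSeq, reflSeq, h] at h1
        simp only [Nat.sub_zero] at h1
        nlinarith
      · exact hlow _ h
  have hrefl : ∀ m, seqLt (reflSeq M (shiftSeq (m + 1) d)) d := fun m =>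
    seqLt_of_piQ_lt hq hd htail (reflSeq_le _) (hrtail m)
  refine ⟨hd.1, hshift, ?_⟩
  intro m
  cases m with
  | succ m => exact hrefl m
  | zero =>
    refine ⟨0, fun i hi => absurd hi (Nat.not_lt_zero i), ?_⟩
    rw [shiftSeq_zero, reflSeq]
    by_contra! hc
    have hconst : ∀ n, d (n + 1) = d 0 := by
      intro n
      have h1 : d (n + 1) ≤ d 0 := (hshift n).head_le
      have h2 : M - d (n + 1) ≤ d 0 := (hrefl n).head_le
      omega
    obtain ⟨n, h1, h2⟩ := hshift 0
    have h3 : d (0 + 1 + n) = d 0 := by rw [show 0 + 1 + n = n + 1 by omega]; exact hconst n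
    have h4 : d n = d 0 := by
      cases n with
      | zero => rfl
      | succ n => exact hconst n
    rw [shiftSeq, h3, h4] at h2
    exact lt_irrefl _ h2

/-- A sequence all of whose shifts are lexicographically at most an expansion `e` of `1` has value
at most `1`. -/
lemma piQ_le_one_of_shifts_le {M : ℕ} {q : ℝ} (hq : 1 < q) {e : ℕ → ℕ} (he : IsExpansion M q 1 e)
    {y : ℕ → ℕ} (hy : ∀ i, y i ≤ M) (hle : ∀ m, seqLe (shiftSeq m y) e) : piQ q y ≤ 1 := by
  have h0 : 0 < q := by linarith
  set K : ℝ := M / (q - 1)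
  have hK : 0 ≤ K := (piQ_nonneg hq y).trans (piQ_le hq hy)
  have hqi : q⁻¹ ≤ 1 := (inv_lt_one_of_one_lt₀ hq).le
  have key : ∀ k m : ℕ, piQ q (shiftSeq m y) ≤ 1 + K * (q⁻¹) ^ k := by
    intro k
    induction k with
    | zero =>
      intro m
      have := piQ_le hq (shiftSeq_le hy m)
      simp only [pow_zero, mul_one]
      linarith
    | succ k ih =>
      intro m
      rcases hle m with ⟨j, hj, hlt⟩ | heq
      · have hv := piQ_sub_of_first_diff hq (shiftSeq_le hy m) he.1 j hj
        rw [he.2, shiftSeq_shiftSeq] at hv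
        have h1 := ih (m + (j + 1))
        have h2 := piQ_nonneg hq (shiftSeq (j + 1) e)
        have h3 : (shiftSeq m y j : ℝ) + 1 ≤ e j := by exact_mod_cast hlt
        have h4 : q ^ (j + 1) * (piQ q (shiftSeq m y) - 1) ≤ K * (q⁻¹) ^ k := by linarith
        have h5 : K * (q⁻¹) ^ k ≤ q ^ (j + 1) * (K * (q⁻¹) ^ (k + 1)) := by
          have h6 : q ^ (j + 1) * (K * (q⁻¹) ^ (k + 1)) = q ^ j * (K * (q⁻¹) ^ k) := by
            rw [pow_succ, pow_succ]; field_simp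
          rw [h6]
          exact le_mul_of_one_le_left (by positivity) (one_le_pow₀ hq.le)
        have := le_of_mul_le_mul_left (h4.trans h5) (by positivity)
        linarith
      · rw [heq, he.2]
        have : 0 ≤ K * (q⁻¹) ^ (k + 1) := by positivity
        linarith
  have hlim : Tendsto (fun k : ℕ => 1 + K * (q⁻¹) ^ k) atTop (nhds (1 + K * 0)) :=
    ((tendsto_pow_atTop_nhds_zero_of_lt_one (by positivity) (inv_lt_one_of_one_lt₀ hq)).const_mul
      K).const_add 1
  have := ge_of_tendsto' hlim fun k => key k 0
  simpa [shiftSeq_zero] using this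

section

variable {M : ℕ} {q : ℝ} {e : ℕ → ℕ}

lemma Admissible.piQ_lt_one (ha : Admissible M e) (hq : 1 < q) (hqM : q < M + 1)
    (he : piQ q e = 1) :
    (∀ n, piQ q (shiftSeq (n + 1) e) < 1) ∧ ∀ n, piQ q (reflSeq M (shiftSeq n e)) < 1 := by
  have hq1 : 0 < q - 1 := by linarith
  have hK : 1 < (M : ℝ) / (q - 1) := by rw [lt_div_iff₀ hq1]; linarith
  have hexp : IsExpansion M q 1 e := ⟨ha.digit_le, he⟩
  have hsh : ∀ m, seqLe (shiftSeq m e) e := by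
    intro m
    cases m with
    | zero => exact Or.inr (shiftSeq_zero e)
    | succ m => exact Or.inl (ha.shift_lt m)
  have hrle : ∀ n, piQ q (reflSeq M (shiftSeq n e)) ≤ 1 := fun n =>
    piQ_le_one_of_shifts_le hq hexp (reflSeq_le _) fun m => by
      rw [shiftSeq_reflSeq, shiftSeq_shiftSeq]
      exact Or.inl (ha.refl_lt _)
  have hsle : ∀ n, piQ q (shiftSeq n e) ≤ 1 := fun n =>
    piQ_le_one_of_shifts_le hq hexp (shiftSeq_le ha.digit_le n) fun m => by
      rw [shiftSeq_shiftSeq]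
      exact hsh _
  have hpos : ∀ n, 0 < piQ q (shiftSeq n e) := by
    intro n
    have := hrle n
    rw [piQ_reflSeq hq (shiftSeq_le ha.digit_le n)] at this
    linarith
  have strict : ∀ y : ℕ → ℕ, (∀ i, y i ≤ M) → (∀ n, piQ q (shiftSeq n y) ≤ 1) → seqLt y e →
      piQ q y < 1 := by
    rintro y hy hyle ⟨j, hj, hlt⟩
    have hv := piQ_sub_of_first_diff hq hy ha.digit_le j hj
    rw [he] at hv
    have h1 : (y j : ℝ) + 1 ≤ e j := by exact_mod_cast hlt
    have h2 : q ^ (j + 1) * (piQ q y - 1) < 0 := by linarith [hyle (j + 1), hpos (j + 1)]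
    have h3 : 0 < q ^ (j + 1) := by positivity
    nlinarith
  refine ⟨fun n => strict _ (shiftSeq_le ha.digit_le _) (fun m => ?_) (ha.shift_lt n),
    fun n => strict _ (reflSeq_le _) (fun m => ?_) (ha.refl_lt n)⟩
  · rw [shiftSeq_shiftSeq]
    exact hsle _
  · rw [shiftSeq_reflSeq, shiftSeq_shiftSeq]
    exact hrle _

/-- A base in which an admissible sequence is an expansion of `1` is univoque. -/
lemma Admissible.mem_univBases (ha : Admissible M e) (hq : 1 < q) (hqM : q < M + 1)
    (he : piQ q e = 1) : q ∈ UnivBases M := by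
  obtain ⟨h1, h2⟩ := ha.piQ_lt_one hq hqM he
  refine ⟨hq, hqM.le, e, ⟨ha.digit_le, he⟩, ?_⟩
  rintro f ⟨hf, hfv⟩
  rcases seqLt_trichotomy f e with ⟨j, hj, hlt⟩ | h | ⟨j, hj, hlt⟩
  · exfalso
    have hv := piQ_sub_of_first_diff hq hf ha.digit_le j hj
    rw [he, hfv, sub_self, mul_zero] at hv
    have h3 := h2 (j + 1)
    rw [piQ_reflSeq hq (shiftSeq_le ha.digit_le _)] at h3
    have h4 := piQ_le hq (shiftSeq_le hf (j + 1))
    have h5 : (f j : ℝ) + 1 ≤ e j := by exact_mod_cast hlt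
    linarith
  · exact h
  · exfalso
    have hv := piQ_sub_of_first_diff hq ha.digit_le hf j hj
    rw [he, hfv, sub_self, mul_zero] at hv
    have h3 := h1 j
    have h4 := piQ_nonneg hq (shiftSeq (j + 1) f)
    have h5 : (e j : ℝ) + 1 ≤ f j := by exact_mod_cast hlt
    linarith

/-- The bases of two admissible expansions of `1` that first differ at position `n` are at least
a constant times `q ^ (-(n + 1))` apart. -/
lemma Admissible.base_separation {p q₁ q₂ : ℝ} {f : ℕ → ℕ} (ha : Admissible M e)
    (hb : Admissible M f) (h₁ : 1 < q₁) (h₂ : q₂ < M + 1) (hp : p ∈ Ioo q₁ q₂)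
    (hq : q ∈ Ioo q₁ q₂) (he : piQ p e = 1) (hf : piQ q f = 1) (n : ℕ)
    (hagree : ∀ i < n, e i = f i) (hlt : e n < f n) :
    M / (q₂ - 1) - 1 ≤ ((M : ℝ) + 1) ^ (n + 1) * (M / (q₁ - 1) ^ 2 * |p - q|) := by
  have hp1 := h₁.trans hp.1
  have hq1 := h₁.trans hq.1
  have hd : (e n : ℝ) + 1 ≤ f n := by exact_mod_cast hlt
  have hpq : p ≤ q := by
    by_contra! hc
    have h1 := (ha.piQ_lt_one hp1 (hp.2.trans h₂) he).1 n
    have h2 := piQ_sub_of_first_diff hp1 hb.digit_le ha.digit_le n fun i hi => (hagree i hi).symm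
    have h3 := piQ_anti hq1 hc.le hb.digit_le
    have h4 := piQ_nonneg hp1 (shiftSeq (n + 1) f)
    rw [he] at h2
    rw [hf] at h3
    have h5 : p ^ (n + 1) * (piQ p f - 1) ≤ 0 :=
      mul_nonpos_of_nonneg_of_nonpos (by positivity) (by linarith)
    linarith
  have h1 := (ha.piQ_lt_one hp1 (hp.2.trans h₂) he).1 n
  have h2 := (hb.piQ_lt_one hq1 (hq.2.trans h₂) hf).2 (n + 1)
  rw [piQ_reflSeq hq1 (shiftSeq_le hb.digit_le _)] at h2
  have h3 := piQ_anti hp1 hpq (shiftSeq_le ha.digit_le (n + 1))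
  have h4 := piQ_sub_of_first_diff hq1 hb.digit_le ha.digit_le n fun i hi => (hagree i hi).symm
  have h5 := piQ_lipschitz h₁ hp.1.le hq.1.le ha.digit_le
  rw [hf] at h4
  rw [he] at h5
  have h6 : (M : ℝ) / (q₂ - 1) ≤ M / (q - 1) := by
    have : 0 < q - 1 := by linarith
    have := hq.2.le
    gcongr
  have h7 : q ^ (n + 1) * (1 - piQ q e) ≤
      ((M : ℝ) + 1) ^ (n + 1) * (M / (q₁ - 1) ^ 2 * |p - q|) := by
    have h8 := (le_abs_self _).trans h5
    have h9 : q ≤ M + 1 := (hq.2.trans h₂).le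
    have h10 : 0 ≤ (M : ℝ) / (q₁ - 1) ^ 2 * |p - q| := by positivity
    calc q ^ (n + 1) * (1 - piQ q e) ≤ q ^ (n + 1) * (M / (q₁ - 1) ^ 2 * |p - q|) := by gcongr
      _ ≤ _ := by gcongr
  linarith

end

/-- Sequences agreeing with `d` on a long prefix are expansions of `1` in a base close to that
of `d`. -/
lemma exists_base_of_agree {M : ℕ} {q q₁ q₂ : ℝ} (h₁ : 1 < q₁) (hq : q ∈ Ioo q₁ q₂)
    {d : ℕ → ℕ} (hd : Admissible M d) (hdv : piQ q d = 1) :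
    ∃ N₀, ∀ N ≥ N₀, ∀ e : ℕ → ℕ, (∀ i, e i ≤ M) → (∀ i < N, e i = d i) →
      ∃ p ∈ Ioo q₁ q₂, piQ p e = 1 := by
  have hq1 := h₁.trans hq.1
  have hq21 := hq1.trans hq.2
  have hpos : 0 < piQ q₂ d := by
    have h0 : 0 < d 0 := by
      have h := hd.refl_lt 0
      obtain ⟨n, h1, h2⟩ := h
      by_contra! hc
      have hall : ∀ n, d n ≤ 0 := by
        intro n
        cases n with
        | zero => exact hc
        | succ n => exact ((hd.shift_lt n).head_le).trans hc
      exact absurd (h2.trans_le (hall n)) (Nat.not_lt_zero _)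
    have h1 := piQ_eq_head hq21 hd.digit_le
    have h2 := piQ_nonneg hq21 (shiftSeq 1 d)
    have h3 : (0 : ℝ) < d 0 := by exact_mod_cast h0
    have h4 : 0 < q₂ * piQ q₂ d := by linarith
    exact pos_of_mul_pos_right h4 (by linarith)
  have hA : 1 < piQ q₁ d := hdv ▸ piQ_strictAnti h₁ hq.1 hd.digit_le (by rw [hdv]; exact one_pos)
  have hB : piQ q₂ d < 1 := hdv ▸ piQ_strictAnti hq1 hq.2 hd.digit_le hpos
  have hclose : ∀ r : ℝ, 1 < r → ∀ ε > 0, ∃ N₀, ∀ N ≥ N₀, ∀ e : ℕ → ℕ, (∀ i, e i ≤ M) →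
      (∀ i < N, e i = d i) → |piQ r e - piQ r d| < ε := by
    intro r hr ε hε
    obtain ⟨N₀, hN₀⟩ := pow_unbounded_of_one_lt (M / (r - 1) / ε) hr
    refine ⟨N₀, fun N hN e he hed => ?_⟩
    have h1 := piQ_sub_of_agree hr he hd.digit_le N hed
    have h2 : |piQ r (shiftSeq N e) - piQ r (shiftSeq N d)| ≤ M / (r - 1) := by
      rw [abs_le]
      constructor <;> linarith [piQ_nonneg hr (shiftSeq N e), piQ_nonneg hr (shiftSeq N d),
        piQ_le hr (shiftSeq_le he N), piQ_le hr (shiftSeq_le hd.digit_le N)]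
    have h3 : 0 < r ^ N := by positivity
    rw [← h1, abs_mul, abs_of_pos h3] at h2
    have h4 : M / (r - 1) < r ^ N * ε := by
      rw [← div_lt_iff₀ hε]
      exact hN₀.trans_le (pow_le_pow_right₀ hr.le hN)
    exact lt_of_mul_lt_mul_left (h2.trans_lt h4) h3.le
  obtain ⟨N₁, hN₁⟩ := hclose q₁ h₁ (piQ q₁ d - 1) (by linarith)
  obtain ⟨N₂, hN₂⟩ := hclose q₂ hq21 (1 - piQ q₂ d) (by linarith)
  refine ⟨max N₁ N₂, fun N hN e he hed => ?_⟩
  have h3 := abs_lt.1 (hN₁ N ((le_max_left _ _).trans hN) e he hed)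
  have h4 := abs_lt.1 (hN₂ N ((le_max_right _ _).trans hN) e he hed)
  have hcont : ContinuousOn (fun p => piQ p e) (Icc q₁ q₂) := by
    have hL : LipschitzOnWith (Real.toNNReal (M / (q₁ - 1) ^ 2)) (fun p => piQ p e)
        (Icc q₁ q₂) := by
      refine LipschitzOnWith.of_dist_le_mul fun x hx y hy => ?_
      rw [Real.coe_toNNReal _ (by positivity), Real.dist_eq, Real.dist_eq]
      exact piQ_lipschitz h₁ hx.1 hy.1 he
    exact hL.continuousOn
  obtain ⟨p, hp, hpv⟩ := intermediate_value_Ioo' (hq.1.trans hq.2).le hcont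
    (show (1 : ℝ) ∈ Ioo (piQ q₂ e) (piQ q₁ e) from ⟨by linarith, by linarith⟩)
  exact ⟨p, hp, hpv⟩

/-! ### Good prefixes and the block substitution -/

/-- `N` is a good length for `d` if no suffix of the word `d_0 ⋯ d_{N-1}` is a prefix of the
reflection of `d`; each suffix is larger than that reflection already within the word. -/
def IsGoodLength (M : ℕ) (d : ℕ → ℕ) (N : ℕ) : Prop :=
  ∀ i < N, ∃ j, i + j < N ∧ (∀ k < j, d (i + k) + d k = M) ∧ M < d (i + j) + d j

section

variable {M N : ℕ} {d : ℕ → ℕ}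

lemma Admissible.exists_refl_diff (hd : Admissible M d) (i : ℕ) :
    ∃ j, (∀ k < j, d (i + k) + d k = M) ∧ M < d (i + j) + d j := by
  obtain ⟨j, h1, h2⟩ := hd.refl_lt i
  have h3 := hd.digit_le (i + j)
  refine ⟨j, fun k hk => ?_, ?_⟩
  · have h4 := hd.digit_le (i + k)
    have h5 : M - d (i + k) = d k := h1 k hk
    omega
  · have h5 : M - d (i + j) < d j := h2
    omega

lemma Admissible.exists_isGoodLength (hd : Admissible M d) (N₀ : ℕ) :
    ∃ N > N₀, IsGoodLength M d N := by
  choose ℓ hℓ hℓ' using hd.exists_refl_diff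
  by_contra! hbad
  have hgood : ∀ N, (∀ i < N, i + ℓ i < N) → N ≤ N₀ := by
    intro N hN
    by_contra! hc
    exact hbad N hc fun i hi => ⟨ℓ i, hN i hi, hℓ i, hℓ' i⟩
  obtain ⟨K, hK⟩ : ∃ K, ∀ i ≤ N₀, i + ℓ i ≤ K :=
    ⟨(Finset.range (N₀ + 1)).sup fun i => i + ℓ i, fun i hi =>
      Finset.le_sup (f := fun i => i + ℓ i) (Finset.mem_range.2 (by omega))⟩
  set n := max K N₀ + 1 with hn
  have hex : ∃ i, i < n ∧ n ≤ i + ℓ i := by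
    by_contra! hc
    have := hgood n hc
    omega
  obtain ⟨hi1, hi2⟩ := Nat.find_spec hex
  have hmin : ∀ j < Nat.find hex, j + ℓ j < n := by
    intro j hj
    have := Nat.find_min hex hj
    push Not at this
    exact this (by omega)
  set i := Nat.find hex
  have hi3 : i ≤ N₀ := by
    refine hgood i fun j hj => ?_
    by_contra! hc
    have hjn := hmin j hj
    obtain ⟨k₀, hk₀⟩ := Nat.exists_eq_add_of_le hc
    have hagree : ∀ k < k₀, d (i - j + k) = d k := by
      intro k hk
      have h1 := hℓ j (i - j + k) (by omega)
      have h2 := hℓ i k (by omega)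
      rw [show j + (i - j + k) = i + k by omega] at h1
      omega
    have hgt : d k₀ < d (i - j + k₀) := by
      have h1 := hℓ' j
      have h2 := hℓ i k₀ (by omega)
      rw [show j + ℓ j = i + k₀ by omega, show ℓ j = i - j + k₀ by omega] at h1
      omega
    obtain ⟨m, hm1, hm2⟩ := hd.shift_lt (i - j - 1)
    rw [show i - j - 1 + 1 = i - j by omega] at hm1 hm2
    simp only [shiftSeq] at hm1 hm2
    rcases lt_trichotomy m k₀ with h | h | h
    · have := hagree m h
      omega
    · subst h
      omega
    · have := hm1 k₀ h
      omega
  have := hK i hi3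
  omega

lemma Admissible.lt_two_mul_head (hd : Admissible M d) : M < d 0 + d 0 := by
  obtain ⟨j, h1, h2⟩ := hd.exists_refl_diff 0
  cases j with
  | zero => simpa using h2
  | succ j =>
    have h3 := h1 0 (by omega)
    have h4 : d (0 + 1 + j) ≤ d 0 := by
      have := (hd.shift_lt j).head_le
      simp only [shiftSeq] at this
      rwa [show 0 + 1 + j = j + 1 + 0 by omega]
    rw [show 0 + 1 + j = j + 1 by omega] at h4
    simp only [Nat.zero_add] at h2 h3
    omega

lemma IsGoodLength.last_pos (hg : IsGoodLength M d N) (hN : 0 < N) (hd : ∀ i, d i ≤ M) :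
    0 < d (N - 1) := by
  obtain ⟨j, h1, h2, h3⟩ := hg (N - 1) (by omega)
  obtain rfl : j = 0 := by omega
  have := hd 0
  simp only [Nat.add_zero] at h3
  omega

/-- The concatenation of blocks coded by a sequence of states: with `w = d_0 ⋯ d_{N-1}`, the
`k`-th block is `w`, `w⁻`, `\overline{w}`, `\overline{w⁻}` according to whether
`(s k, s (k + 1))` is `(false, true)`, `(false, false)`, `(true, false)`, `(true, true)`. -/
def blockSeq (M N : ℕ) (d : ℕ → ℕ) (s : ℕ → Bool) : ℕ → ℕ := fun m =>
  if s (m / N) = true then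
    (M - d (m % N)) + (if m % N + 1 = N ∧ s (m / N + 1) = true then 1 else 0)
  else d (m % N) - (if m % N + 1 = N ∧ s (m / N + 1) = false then 1 else 0)

lemma blockSeq_le (hg : IsGoodLength M d N) (hN : 0 < N) (hd : ∀ i, d i ≤ M) (s : ℕ → Bool)
    (i : ℕ) : blockSeq M N d s i ≤ M := by
  have h1 := hg.last_pos hN hd
  have h2 := hd (i % N)
  unfold blockSeq
  split_ifs with h3 h4 h5
  · have : i % N = N - 1 := by omega
    rw [this] at h2 ⊢
    omega
  all_goals omega

lemma reflSeq_blockSeq (hg : IsGoodLength M d N) (hN : 0 < N) (hd : ∀ i, d i ≤ M)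
    (s : ℕ → Bool) : reflSeq M (blockSeq M N d s) = blockSeq M N d fun i => !s i := by
  funext i
  have h1 := hg.last_pos hN hd
  have h2 := hd (i % N)
  by_cases hl : i % N + 1 = N
  · have h3 : i % N = N - 1 := by omega
    rw [← h3] at h1
    simp only [reflSeq, blockSeq, hl, true_and]
    cases s (i / N) <;> cases s (i / N + 1) <;> simp <;> omega
  · simp only [reflSeq, blockSeq, hl, false_and]
    cases s (i / N) <;> simp; omega

lemma shiftSeq_blockSeq (hN : 0 < N) (s : ℕ → Bool) (k : ℕ) :
    shiftSeq (N * k) (blockSeq M N d s) = blockSeq M N d fun i => s (k + i) := by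
  funext i
  simp only [shiftSeq, blockSeq, Nat.mul_add_div hN, Nat.mul_add_mod, Nat.add_assoc]

lemma blockSeq_apply (s : ℕ → Bool) {n m : ℕ} (hm : m + 1 < N) :
    blockSeq M N d s (N * n + m) = if s n = true then M - d m else d m := by
  have h1 : m < N := by omega
  have h2 : ¬ m + 1 = N := by omega
  simp [blockSeq, Nat.mul_add_div (show 0 < N by omega), Nat.mod_eq_of_lt h1,
    Nat.div_eq_of_lt h1, h2]

lemma blockSeq_apply_last (s : ℕ → Bool) {n m : ℕ} (hm : m + 1 = N) :
    blockSeq M N d s (N * n + m) =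
      if s n = true then M - d m + (if s (n + 1) = true then 1 else 0)
      else d m - (if s (n + 1) = true then 0 else 1) := by
  have h1 : m < N := by omega
  simp only [blockSeq, Nat.mul_add_div (show 0 < N by omega), Nat.mul_add_mod,
    Nat.mod_eq_of_lt h1, Nat.div_eq_of_lt h1, hm, true_and, Nat.add_zero]
  cases s n <;> cases s (n + 1) <;> simp

/-- Replacing the first differing state `false` by `true` increases the block sequence, the first
change occurring in the last digit of the preceding block. -/
lemma blockSeq_first_diff (hN : 0 < N) (hlast : 0 < d (N - 1)) {s s' : ℕ → Bool} {n : ℕ}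
    (hagree : ∀ k ≤ n, s k = s' k) (hs : s (n + 1) = false) (hs' : s' (n + 1) = true) :
    (∀ i < N * n + (N - 1), blockSeq M N d s i = blockSeq M N d s' i) ∧
      blockSeq M N d s (N * n + (N - 1)) < blockSeq M N d s' (N * n + (N - 1)) := by
  constructor
  · intro i hi
    obtain ⟨k, m, hm, rfl⟩ : ∃ k m, m < N ∧ i = N * k + m :=
      ⟨i / N, i % N, Nat.mod_lt _ hN, (Nat.div_add_mod i N).symm⟩
    have hk : k ≤ n := by
      by_contra! hc
      have := Nat.mul_le_mul_left N (show n + 1 ≤ k from hc)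
      rw [Nat.mul_add] at this
      omega
    rcases Nat.lt_or_ge (m + 1) N with h | h
    · rw [blockSeq_apply s h, blockSeq_apply s' h, hagree k hk]
    · have h' : m + 1 = N := by omega
      have hkn : k ≠ n := by
        rintro rfl
        omega
      rw [blockSeq_apply_last s h', blockSeq_apply_last s' h', hagree k hk,
        hagree (k + 1) (by omega)]
  · have h : N - 1 + 1 = N := by omega
    rw [blockSeq_apply_last s h, blockSeq_apply_last s' h, hagree n le_rfl, hs, hs']
    cases s' n <;> simp
    exact hlast

/-- Shifts of a block sequence by less than a block are smaller than anything starting with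
`d_0 ⋯ d_{N-1}`. -/
lemma seqLt_shift_blockSeq (hd : Admissible M d) (hg : IsGoodLength M d N) (s : ℕ → Bool) {i : ℕ}
    (hi : 0 < i) (hiN : i < N) {x : ℕ → ℕ} (hx : ∀ k < N, x k = d k) :
    seqLt (shiftSeq i (blockSeq M N d s)) x := by
  have hlast := hg.last_pos (by omega) hd.digit_le
  have v0 : ∀ m, m + 1 < N → blockSeq M N d s m = if s 0 = true then M - d m else d m :=
    fun m hm => by simpa using blockSeq_apply (M := M) (d := d) s (n := 0) hm
  have v0' : blockSeq M N d s (N - 1) =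
      if s 0 = true then M - d (N - 1) + (if s 1 = true then 1 else 0)
      else d (N - 1) - (if s 1 = true then 0 else 1) := by
    simpa using blockSeq_apply_last (M := M) (d := d) s (n := 0) (show N - 1 + 1 = N by omega)
  have v1 : ∀ m, m + 1 < N → blockSeq M N d s (N + m) = if s 1 = true then M - d m else d m :=
    fun m hm => by simpa using blockSeq_apply (M := M) (d := d) s (n := 1) hm
  have next : s 1 = true → (∀ t, i + t < N → blockSeq M N d s (i + t) = d t) →
      seqLt (shiftSeq i (blockSeq M N d s)) x := by
    intro hs1 hpre
    obtain ⟨j, hj1, hj2, hj3⟩ := hg (N - i) (by omega)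
    refine ⟨N - i + j, fun t ht => ?_, ?_⟩
    · simp only [shiftSeq]
      rw [hx t (by omega)]
      rcases Nat.lt_or_ge (i + t) N with h | h
      · exact hpre t h
      · obtain ⟨k, rfl⟩ := Nat.exists_eq_add_of_le (show N - i ≤ t by omega)
        have := hj2 k (by omega)
        rw [show i + (N - i + k) = N + k by omega, v1 k (by omega), if_pos hs1]
        omega
    · simp only [shiftSeq]
      rw [hx _ (by omega), show i + (N - i + j) = N + j by omega, v1 j (by omega), if_pos hs1]
      have := hd.digit_le (N - i + j)
      have := hd.digit_le j
      omega
  cases hs0 : s 0 with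
  | false =>
    simp only [hs0, Bool.false_eq_true, if_false] at v0 v0'
    obtain ⟨j, hj1, hj2⟩ := hd.shift_lt (i - 1)
    rw [Nat.sub_add_cancel hi] at hj1 hj2
    simp only [shiftSeq] at hj1 hj2
    rcases Nat.lt_or_ge (i + j) N with h | h
    · refine ⟨j, fun t ht => ?_, ?_⟩
      · simp only [shiftSeq]
        rw [hx t (by omega), v0 _ (by omega), hj1 t ht]
      · simp only [shiftSeq]
        rw [hx j (by omega)]
        rcases Nat.lt_or_ge (i + j + 1) N with h' | h'
        · rw [v0 _ h']
          exact hj2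
        · rw [show i + j = N - 1 by omega] at hj2 ⊢
          rw [v0']
          omega
    · cases hs1 : s 1 with
      | false =>
        simp only [hs1, Bool.false_eq_true, if_false] at v0'
        have hj := hj1 (N - 1 - i) (by omega)
        rw [show i + (N - 1 - i) = N - 1 by omega] at hj
        refine ⟨N - 1 - i, fun t ht => ?_, ?_⟩
        · simp only [shiftSeq]
          rw [hx t (by omega), v0 _ (by omega), hj1 t (by omega)]
        · simp only [shiftSeq]
          rw [hx _ (by omega), show i + (N - 1 - i) = N - 1 by omega, v0']
          omega
      | true =>
        refine next hs1 fun t ht => ?_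
        rcases Nat.lt_or_ge (i + t + 1) N with h' | h'
        · rw [v0 _ h', hj1 t (by omega)]
        · have hj := hj1 t (by omega)
          rw [show i + t = N - 1 by omega] at hj ⊢
          rw [v0', hs1, hj]
          simp
  | true =>
    simp only [hs0, if_true] at v0 v0'
    obtain ⟨j, hj1, hj2, hj3⟩ := hg i hiN
    have hpre : ∀ t < j, shiftSeq i (blockSeq M N d s) t = x t := by
      intro t ht
      have := hj2 t ht
      simp only [shiftSeq]
      rw [hx t (by omega), v0 _ (by omega)]
      omega
    by_cases hlt : shiftSeq i (blockSeq M N d s) j < x j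
    · exact ⟨j, hpre, hlt⟩
    · simp only [shiftSeq] at hlt
      rw [hx j (by omega)] at hlt
      have hdi := hd.digit_le (i + j)
      have hdj := hd.digit_le j
      rcases Nat.lt_or_ge (i + j + 1) N with h' | h'
      · rw [v0 _ h'] at hlt
        omega
      · have hN1 : i + j = N - 1 := by omega
        rw [hN1] at hlt hj3 hdi
        cases hs1 : s 1 with
        | false =>
          simp only [v0', hs1, Bool.false_eq_true, if_false] at hlt
          omega
        | true =>
          simp only [hs1, if_true] at v0'
          refine next hs1 fun t ht => ?_
          rcases Nat.lt_or_ge t j with h2 | h2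
          · have := hpre t h2
            rwa [hx t (by omega)] at this
          · obtain rfl : t = j := by omega
            rw [hN1, v0'] at *
            omega

lemma blockSeq_eq_of_lt {s : ℕ → Bool} (h0 : s 0 = false) (h1 : s 1 = true) {k : ℕ}
    (hk : k < N) : blockSeq M N d s k = d k := by
  rcases Nat.lt_or_ge (k + 1) N with h | h
  · simpa [h0] using blockSeq_apply (M := M) (d := d) s (n := 0) h
  · simpa [h0, h1] using blockSeq_apply_last (M := M) (d := d) s (n := 0) (show k + 1 = N by omega)

/-- A state sequence starting with `0111`, with no further occurrence of `0111` and no occurrence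
of `1000`, codes an admissible sequence. -/
lemma admissible_blockSeq (hd : Admissible M d) (hg : IsGoodLength M d N) (hN : 1 < N)
    {s : ℕ → Bool} (h0 : s 0 = false) (h1 : s 1 = true) (h2 : s 2 = true) (h3 : s 3 = true)
    (hup : ∀ k, s (k + 1) = true ∨ s (k + 2) = false ∨ s (k + 3) = false ∨ s (k + 4) = false)
    (hlow : ∀ k, s k = false ∨ s (k + 1) = true ∨ s (k + 2) = true ∨ s (k + 3) = true) :
    Admissible M (blockSeq M N d s) := by
  have hN0 : 0 < N := by omega
  have hpre : ∀ k < N, blockSeq M N d s k = d k := fun k hk => blockSeq_eq_of_lt h0 h1 hk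
  have hlast := hg.last_pos hN0 hd.digit_le
  have key : ∀ s' : ℕ → Bool, (s' 0 = true ∨ s' 1 = false ∨ s' 2 = false ∨ s' 3 = false) →
      ∀ i < N, seqLt (shiftSeq i (blockSeq M N d s')) (blockSeq M N d s) := by
    intro s' hs' i hi
    rcases Nat.eq_zero_or_pos i with rfl | hi0
    · rw [shiftSeq_zero]
      cases hs0 : s' 0 with
      | true =>
        refine ⟨0, fun i hi => absurd hi (Nat.not_lt_zero i), ?_⟩
        have h := blockSeq_apply (M := M) (d := d) s' (n := 0) (m := 0) hN
        rw [hs0] at h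
        simp only [Nat.mul_zero, Nat.add_zero, if_true] at h
        rw [h, hpre 0 hN0]
        have := hd.lt_two_mul_head
        have := hd.digit_le 0
        omega
      | false =>
        have fin : ∀ n, (∀ k ≤ n, s' k = s k) → s' (n + 1) = false → s (n + 1) = true →
            seqLt (blockSeq M N d s') (blockSeq M N d s) := fun n ha hb hc =>
          ⟨_, (blockSeq_first_diff hN0 hlast ha hb hc)⟩
        cases hs1 : s' 1 with
        | false =>
          refine fin 0 (fun k hk => ?_) hs1 h1
          interval_cases k
          rw [hs0, h0]
        | true =>
          cases hs2 : s' 2 with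
          | false =>
            refine fin 1 (fun k hk => ?_) hs2 h2
            interval_cases k
            · rw [hs0, h0]
            · rw [hs1, h1]
          | true =>
            have hs3 : s' 3 = false := by simpa [hs0, hs1, hs2] using hs'
            refine fin 2 (fun k hk => ?_) hs3 h3
            interval_cases k
            · rw [hs0, h0]
            · rw [hs1, h1]
            · rw [hs2, h2]
    · exact seqLt_shift_blockSeq hd hg s' hi0 hi hpre
  have hsplit : ∀ m, shiftSeq m (blockSeq M N d s) =
      shiftSeq (m % N) (blockSeq M N d fun i => s (m / N + i)) := by
    intro m
    rw [← shiftSeq_blockSeq hN0, shiftSeq_shiftSeq, Nat.div_add_mod]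
  refine ⟨blockSeq_le hg hN0 hd.digit_le s, fun m => ?_, fun m => ?_⟩
  · rw [hsplit]
    rcases Nat.eq_zero_or_pos ((m + 1) % N) with h | h
    · have hk : 0 < (m + 1) / N :=
        Nat.div_pos (Nat.le_of_dvd (Nat.succ_pos m) (Nat.dvd_of_mod_eq_zero h)) hN0
      obtain ⟨k, hk'⟩ := Nat.exists_eq_add_of_lt hk
      refine key _ ?_ _ (Nat.mod_lt _ hN0)
      have := hup k
      rw [hk']
      simpa [Nat.add_assoc] using this
    · exact seqLt_shift_blockSeq hd hg _ h (Nat.mod_lt _ hN0) hpre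
  · rw [hsplit, ← shiftSeq_reflSeq, reflSeq_blockSeq hg hN0 hd.digit_le]
    refine key _ ?_ _ (Nat.mod_lt _ hN0)
    simpa using hlow (m / N)

end

/-- The state sequence `0111 0 t_0 1 0 t_1 1 ⋯`. -/
def stateSeq (t : ℕ → Fin 2) : ℕ → Bool := fun n =>
  if n < 4 then decide (n ≠ 0)
  else if n % 3 = 0 then true
  else if n % 3 = 1 then false
  else decide (t (n / 3 - 1) = 1)

lemma stateSeq_of_mod_zero (t : ℕ → Fin 2) {n : ℕ} (h0 : 0 < n) (h : n % 3 = 0) :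
    stateSeq t n = true := by
  have h1 : n ≠ 0 := h0.ne'
  simp [stateSeq, h, h1]

lemma stateSeq_of_mod_one (t : ℕ → Fin 2) {n : ℕ} (h1 : 1 < n) (h : n % 3 = 1) :
    stateSeq t n = false := by
  by_cases h4 : n < 4
  · have : n ≠ 1 := by omega
    have : n ≠ 2 := by omega
    have : n ≠ 3 := by omega
    omega
  · simp [stateSeq, h, h4]

lemma stateSeq_free (t : ℕ → Fin 2) (k : ℕ) : stateSeq t (5 + 3 * k) = decide (t k = 1) := by
  have h1 : ¬ 5 + 3 * k < 4 := by omega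
  have h2 : (5 + 3 * k) % 3 = 2 := by omega
  have h3 : (5 + 3 * k) / 3 - 1 = k := by omega
  simp [stateSeq, h1, h2, h3]

lemma stateSeq_agree {t t' : ℕ → Fin 2} {k : ℕ} (h : ∀ i < k, t i = t' i) (n : ℕ)
    (hn : n ≤ 4 + 3 * k) : stateSeq t n = stateSeq t' n := by
  unfold stateSeq
  split_ifs
  · rfl
  · rfl
  · rfl
  · rw [h _ (by omega)]

lemma admissible_blockSeq_stateSeq {M N : ℕ} {d : ℕ → ℕ} (hd : Admissible M d)
    (hg : IsGoodLength M d N) (hN : 1 < N) (t : ℕ → Fin 2) :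
    Admissible M (blockSeq M N d (stateSeq t)) := by
  refine admissible_blockSeq hd hg hN (by simp [stateSeq]) (by simp [stateSeq])
    (by simp [stateSeq]) (by simp [stateSeq]) (fun k => ?_) (fun k => ?_)
  · by_cases hk : k < 3
    · left
      have : k + 1 < 4 := by omega
      simp [stateSeq, this]
    · right
      rcases (by omega : (k + 2) % 3 = 1 ∨ (k + 3) % 3 = 1 ∨ (k + 4) % 3 = 1) with h | h | h
      · exact Or.inl (stateSeq_of_mod_one t (by omega) h)
      · exact Or.inr (Or.inl (stateSeq_of_mod_one t (by omega) h))
      · exact Or.inr (Or.inr (stateSeq_of_mod_one t (by omega) h))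
  · right
    rcases (by omega : (k + 1) % 3 = 0 ∨ (k + 2) % 3 = 0 ∨ (k + 3) % 3 = 0) with h | h | h
    · exact Or.inl (stateSeq_of_mod_zero t (by omega) h)
    · exact Or.inr (Or.inl (stateSeq_of_mod_zero t (by omega) h))
    · exact Or.inr (Or.inr (stateSeq_of_mod_zero t (by omega) h))

/-! ### Positive dimension -/

/-- A map from binary sequences to `ℝ` separating points at an exponential rate has range of positive
dimension. -/
lemma dimH_range_pos (Φ : (ℕ → Fin 2) → ℝ) {c Q : ℝ} (hc : 0 < c) (hQ : 1 < Q)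
    (h : ∀ t t' k, (∀ i < k, t i = t' i) → t k ≠ t' k → c ≤ Q ^ k * |Φ t - Φ t'|) :
    0 < dimH (range Φ) := by
  have hsep : ∀ t t', t ≠ t' →
      ∃ k, (∀ i < k, t i = t' i) ∧ c ≤ Q ^ k * |Φ t - Φ t'| := by
    classical
    intro t t' hne
    have hex : ∃ k, t k ≠ t' k := Function.ne_iff.1 hne
    have hlt : ∀ i < Nat.find hex, t i = t' i := fun i hi => not_not.1 (Nat.find_min hex hi)
    exact ⟨_, hlt, h _ _ _ hlt (Nat.find_spec hex)⟩
  have hinj : Function.Injective Φ := by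
    intro t t' heq
    by_contra hne
    obtain ⟨k, -, hk⟩ := hsep t t' hne
    rw [heq, sub_self, abs_zero, mul_zero] at hk
    exact absurd hk (not_le.2 hc)
  have hlogQ : 0 < Real.log Q := Real.log_pos hQ
  set r : ℝ := Real.log 2 / Real.log Q with hr
  have hrpos : 0 < r := div_pos (Real.log_pos one_lt_two) hlogQ
  have hQr : Q ^ r = 2 := by
    rw [Real.rpow_def_of_pos (zero_lt_one.trans hQ), hr, mul_div_cancel₀ _ hlogQ.ne',
      Real.exp_log two_pos]
  set f : ℝ → ℝ := fun x => Real.ofDigits (Function.invFun Φ x) with hf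
  have hfΦ : ∀ t, f (Φ t) = Real.ofDigits t := fun t => by
    simp only [hf, Function.leftInverse_invFun hinj t]
  have hcr : 0 < c ^ r := Real.rpow_pos_of_pos hc r
  have hbound : ∀ t t', |f (Φ t) - f (Φ t')| ≤ (c ^ r)⁻¹ * |Φ t - Φ t'| ^ r := by
    intro t t'
    by_cases hne : t = t'
    · subst hne
      simp [Real.zero_rpow hrpos.ne']
    obtain ⟨k, hk, hle⟩ := hsep t t' hne
    rw [hfΦ, hfΦ]
    have h2 : |Real.ofDigits t - Real.ofDigits t'| ≤ ((2 : ℝ) ^ k)⁻¹ := by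
      simpa using Real.abs_ofDigits_sub_ofDigits_le hk
    have h3 : c ^ r ≤ 2 ^ k * |Φ t - Φ t'| ^ r := by
      have hQ0 : 0 ≤ Q := by linarith
      calc c ^ r ≤ (Q ^ k * |Φ t - Φ t'|) ^ r := Real.rpow_le_rpow hc.le hle hrpos.le
        _ = 2 ^ k * |Φ t - Φ t'| ^ r := by
          rw [Real.mul_rpow (pow_nonneg hQ0 k) (abs_nonneg _), ← Real.rpow_natCast,
            ← Real.rpow_mul hQ0, mul_comm (k : ℝ), Real.rpow_mul hQ0, hQr, Real.rpow_natCast]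
    refine h2.trans ?_
    rw [inv_mul_eq_div, le_div_iff₀ hcr, inv_mul_le_iff₀ (by positivity)]
    exact h3
  have hholder : HolderOnWith (c ^ r)⁻¹.toNNReal r.toNNReal f (range Φ) := by
    rintro _ ⟨t, rfl⟩ _ ⟨t', rfl⟩
    rw [edist_dist, edist_dist, Real.dist_eq, Real.dist_eq, Real.coe_toNNReal r hrpos.le,
      ENNReal.ofReal_rpow_of_nonneg (abs_nonneg _) hrpos.le]
    change _ ≤ ENNReal.ofReal _ * _
    rw [← ENNReal.ofReal_mul (inv_nonneg.2 hcr.le)]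
    exact ENNReal.ofReal_le_ofReal (hbound t t')
  have hsub : Icc (0 : ℝ) 1 ⊆ f '' range Φ := by
    intro x hx
    obtain ⟨t, -, ht⟩ := Real.ofDigits_SurjOn one_lt_two hx
    exact ⟨Φ t, ⟨t, rfl⟩, (hfΦ t).trans ht⟩
  have hdim : dimH (Icc (0 : ℝ) 1) = 1 := by
    rw [Real.dimH_of_nonempty_interior (by simp [interior_Icc])]
    simp
  have hle := (dimH_mono hsub).trans (hholder.dimH_image_le (Real.toNNReal_pos.2 hrpos))
  rw [hdim] at hle
  refine pos_iff_ne_zero.2 fun h0 => ?_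
  rw [h0, ENNReal.zero_div] at hle
  exact absurd hle (by simp)

/-- The set of univoque bases has positive dimension near each of its points below `M + 1`. -/
lemma dimH_univBases_inter_Ioo_pos {M : ℕ} {q x y : ℝ} (hq : q ∈ UnivBases M) (hqM : q < M + 1)
    (hx : x < q) (hy : q < y) : 0 < dimH (UnivBases M ∩ Ioo x y) := by
  obtain ⟨hq1, -, d, hd, huniq⟩ := hq
  have ha : Admissible M d := admissible_of_unique hq1 hqM hd huniq
  obtain ⟨q₁, hq₁, hq₁q⟩ := exists_between (max_lt hq1 hx)
  obtain ⟨q₂, hqq₂, hq₂⟩ := exists_between (lt_min hy hqM)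
  obtain ⟨h₁, hx₁⟩ := max_lt_iff.1 hq₁
  obtain ⟨hy₂, h₂⟩ := lt_min_iff.1 hq₂
  obtain ⟨N₀, hN₀⟩ := exists_base_of_agree h₁ ⟨hq₁q, hqq₂⟩ ha hd.2
  obtain ⟨N, hN, hg⟩ := ha.exists_isGoodLength (max N₀ 1)
  obtain ⟨hNN₀, hN1⟩ := max_lt_iff.1 hN
  have hN0 : 0 < N := by omega
  have hadm : ∀ t, Admissible M (blockSeq M N d (stateSeq t)) :=
    fun t => admissible_blockSeq_stateSeq ha hg hN1 t
  have hex : ∀ t, ∃ p ∈ Ioo q₁ q₂, piQ p (blockSeq M N d (stateSeq t)) = 1 := fun t =>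
    hN₀ N hNN₀.le _ (hadm t).digit_le fun i hi => blockSeq_eq_of_lt rfl rfl hi
  choose Φ hΦ hΦ1 using hex
  have hsub : range Φ ⊆ UnivBases M ∩ Ioo x y := by
    rintro _ ⟨t, rfl⟩
    exact ⟨(hadm t).mem_univBases (h₁.trans (hΦ t).1) ((hΦ t).2.trans h₂) (hΦ1 t),
      hx₁.trans (hΦ t).1, (hΦ t).2.trans hy₂⟩
  refine lt_of_lt_of_le ?_ (dimH_mono hsub)
  have hM : (0 : ℝ) < M := by linarith
  have hL : 0 < (M : ℝ) / (q₁ - 1) ^ 2 := by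
    have : 0 < q₁ - 1 := by linarith
    positivity
  have hgap : 0 < (M : ℝ) / (q₂ - 1) - 1 := by
    rw [sub_pos, one_lt_div (by linarith)]
    linarith
  have hpow : 0 < ((M : ℝ) + 1) ^ (5 * N) := by positivity
  have key : ∀ t t' k, (∀ i < k, t i = t' i) → t k = 0 → t' k = 1 →
      (M : ℝ) / (q₂ - 1) - 1 ≤
        ((M : ℝ) + 1) ^ (N * (5 + 3 * k)) * (M / (q₁ - 1) ^ 2 * |Φ t - Φ t'|) := by
    intro t t' k hk h0 h1
    obtain ⟨hag, hlt⟩ := blockSeq_first_diff (M := M) (d := d) hN0 (hg.last_pos hN0 hd.1)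
      (stateSeq_agree hk)
      (by rw [show 4 + 3 * k + 1 = 5 + 3 * k by omega, stateSeq_free]; simp [h0])
      (by rw [show 4 + 3 * k + 1 = 5 + 3 * k by omega, stateSeq_free]; simp [h1])
    have hexp : N * (4 + 3 * k) + (N - 1) + 1 = N * (5 + 3 * k) := by
      obtain ⟨n, rfl⟩ := Nat.exists_eq_succ_of_ne_zero hN0.ne'
      simp only [Nat.succ_eq_add_one, Nat.add_sub_cancel]
      ring
    have hs := (hadm t).base_separation (hadm t') h₁ h₂ (hΦ t) (hΦ t') (hΦ1 t) (hΦ1 t') _ hag hlt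
    rwa [hexp] at hs
  refine dimH_range_pos Φ (c := ((M : ℝ) / (q₂ - 1) - 1) /
    (M / (q₁ - 1) ^ 2 * ((M : ℝ) + 1) ^ (5 * N))) (Q := ((M : ℝ) + 1) ^ (3 * N))
    (by positivity) (one_lt_pow₀ (by linarith) (by omega)) fun t t' k hk hne => ?_
  have hmain : (M : ℝ) / (q₂ - 1) - 1 ≤
      ((M : ℝ) + 1) ^ (N * (5 + 3 * k)) * (M / (q₁ - 1) ^ 2 * |Φ t - Φ t'|) := by
    rcases (by omega : (t k = 0 ∧ t' k = 1) ∨ (t k = 1 ∧ t' k = 0)) with ⟨h, h'⟩ | ⟨h, h'⟩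
    · exact key t t' k hk h h'
    · rw [abs_sub_comm]
      exact key t' t k (fun i hi => (hk i hi).symm) h' h
  rw [div_le_iff₀ (mul_pos hL hpow)]
  refine hmain.trans_eq ?_
  rw [← pow_mul, show N * (5 + 3 * k) = 3 * N * k + 5 * N by ring, pow_add]
  ring

/-- For a connected component `(q₀, q₀^*)` of `(q', M+1) \ closure U`, the
Hausdorff dimension of `U ∩ (q₀^*, r)` is strictly positive for every
`r ∈ (q₀^*, M+1]`. -/
theorem stmt16 (M : ℕ) (hM : 0 < M) (q₀ q₀star : ℝ) (hcc : CC M q₀ q₀star) :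
    ∀ r ∈ Ioc q₀star ((M : ℝ) + 1),
      0 < dimH (UnivBases M ∩ Ioo q₀star r) := by
  rintro r ⟨hr, hrM⟩
  obtain ⟨hab, hsub, -, hb⟩ := hcc
  obtain ⟨m, hm⟩ := exists_between hab
  have hKL : KL M < q₀star := (hsub hm).1.1.trans hm.2
  have hbcl : q₀star ∈ closure (UnivBases M) := by
    by_contra h
    exact hb ⟨⟨hKL, hr.trans_le hrM⟩, h⟩
  obtain ⟨q, hqU, hqd⟩ := Metric.mem_closure_iff.1 hbcl (min (q₀star - q₀) (r - q₀star))
    (lt_min (sub_pos.2 hab) (sub_pos.2 hr))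
  rw [Real.dist_eq, lt_min_iff, abs_lt, abs_lt] at hqd
  obtain ⟨⟨-, hq₀⟩, hqr, -⟩ := hqd
  have hpos : 0 < dimH (UnivBases M ∩ Ioo q₀ r) :=
    dimH_univBases_inter_Ioo_pos hqU (by linarith) (by linarith) (by linarith)
  have hcover : UnivBases M ∩ Ioo q₀ r ⊆ {q₀star} ∪ (UnivBases M ∩ Ioo q₀star r) := by
    rintro p ⟨hpU, hp, hpr⟩
    rcases lt_trichotomy p q₀star with h | h | h
    · exact absurd (subset_closure hpU) (hsub ⟨hp, h⟩).2
    · exact Or.inl h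
    · exact Or.inr ⟨hpU, h, hpr⟩
  have hle := hpos.trans_le (dimH_mono hcover)
  rwa [dimH_union, dimH_singleton, zero_max] at hle

end
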